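/- Fix n ≥ 2, w ∈ S_n, and k ∈ {1,…,n−1}. Then max_k(w) > min_k(w) if and only if some reduced decomposition of w contains three consecutive factors equal to σ_k σ_{k−1} σ_k or to σ_k σ_{k+1} σ_k. -/

import Mathlib

/-- The simple reflection `σ_i = (i, i+1)`, acting on `ℕ` (1-indexed positions/values). -/
def simpleRefl (i : ℕ) : Equiv.Perm ℕ := Equiv.swap i (i + 1)

/-- `w` is a permutation of `{1, …, n}`: it fixes every point outside `[1, n]`. -/
def IsPermOf (n : ℕ) (w : Equiv.Perm ℕ) : Prop :=
  ∀ x : ℕ, x ∉ Finset.Icc 1 n → w x = x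

/-- The Coxeter length of `w`: its number of inversions on `{1, …, n}`. -/
def len (n : ℕ) (w : Equiv.Perm ℕ) : ℕ :=
  ((Finset.Icc 1 n ×ˢ Finset.Icc 1 n).filter fun p => p.1 < p.2 ∧ w p.2 < w p.1).card

/-- `L` is a word for `w`: a list of indices in `[1, n-1]` whose associated product of
simple reflections (read left to right) is `w`. -/
def IsWord (n : ℕ) (w : Equiv.Perm ℕ) (L : List ℕ) : Prop :=
  (∀ i ∈ L, 1 ≤ i ∧ i ≤ n - 1) ∧ (L.map simpleRefl).prod = w

/-- `L` is a reduced decomposition of `w`. -/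
def IsReducedWord (n : ℕ) (w : Equiv.Perm ℕ) (L : List ℕ) : Prop :=
  IsWord n w L ∧ L.length = len n w

/-- `min_k(w)`: the minimum number of occurrences of `σ_k` in a reduced decomposition of `w`. -/
noncomputable def minOcc (n k : ℕ) (w : Equiv.Perm ℕ) : ℕ :=
  sInf {m | ∃ L : List ℕ, IsReducedWord n w L ∧ L.count k = m}

/-- `max_k(w)`: the maximum number of occurrences of `σ_k` in a reduced decomposition of `w`. -/
noncomputable def maxOcc (n k : ℕ) (w : Equiv.Perm ℕ) : ℕ :=
  sSup {m | ∃ L : List ℕ, IsReducedWord n w L ∧ L.count k = m}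

/-- `expat_k(w) = |{w(1),…,w(k)} ∩ {k+1,…,n}|`. -/
def expat (n k : ℕ) (w : Equiv.Perm ℕ) : ℕ :=
  (((Finset.Icc 1 k).image fun i => w i) ∩ Finset.Icc (k + 1) n).card

/-- A `321`-pattern of `w` in positions `i1 < i2 < i3` (within `[1, n]`). -/
def Is321At (n : ℕ) (w : Equiv.Perm ℕ) (i1 i2 i3 : ℕ) : Prop :=
  1 ≤ i1 ∧ i1 < i2 ∧ i2 < i3 ∧ i3 ≤ n ∧ w i3 < w i2 ∧ w i2 < w i1

/-- A `3412`-pattern of `w` in positions `i1 < i2 < i3 < i4` (within `[1, n]`). -/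
def Is3412At (n : ℕ) (w : Equiv.Perm ℕ) (i1 i2 i3 i4 : ℕ) : Prop :=
  1 ≤ i1 ∧ i1 < i2 ∧ i2 < i3 ∧ i3 < i4 ∧ i4 ≤ n ∧
    w i3 < w i4 ∧ w i4 < w i1 ∧ w i1 < w i2

/-- `p` is a position pair at `k`: `p = (i1, i3)` for a `321`-pattern with `i1 ≤ k < i3`,
or `p = (i2, i3)` for a `3412`-pattern with `i2 ≤ k < i3`. -/
def IsPosPair (n k : ℕ) (w : Equiv.Perm ℕ) (p : ℕ × ℕ) : Prop :=
  (∃ i2, Is321At n w p.1 i2 p.2 ∧ p.1 ≤ k ∧ k < p.2) ∨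
  (∃ i1 i4, Is3412At n w i1 p.1 p.2 i4 ∧ p.1 ≤ k ∧ k < p.2)

/-- `p` is a value pair at `k`: `p = (j3, j1)` for a `321`-pattern with values
`j1 < j2 < j3` and `j1 ≤ k < j3`, or `p = (j4, j1)` for a `3412`-pattern with values
`j1 < j2 < j3 < j4` and `j2 ≤ k < j3`. -/
def IsValPair (n k : ℕ) (w : Equiv.Perm ℕ) (p : ℕ × ℕ) : Prop :=
  (∃ i1 i2 i3, Is321At n w i1 i2 i3 ∧ w i3 ≤ k ∧ k < w i1 ∧ p = (w i1, w i3)) ∨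
  (∃ i1 i2 i3 i4, Is3412At n w i1 i2 i3 i4 ∧ w i4 ≤ k ∧ k < w i1 ∧ p = (w i2, w i3))

/-- `PosPair_k(w)`: the number of distinct position pairs at `k` in `w`. -/
noncomputable def posPairCount (n k : ℕ) (w : Equiv.Perm ℕ) : ℕ :=
  Set.ncard {p : ℕ × ℕ | IsPosPair n k w p}

/-- `ValPair_k(w)`: the number of distinct value pairs at `k` in `w`. -/
noncomputable def valPairCount (n k : ℕ) (w : Equiv.Perm ℕ) : ℕ :=
  Set.ncard {p : ℕ × ℕ | IsValPair n k w p}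

theorem p_apply_inv (w : Equiv.Perm ℕ) (x : ℕ) : w (w⁻¹ x) = x := by simp

theorem p_inv_apply (w : Equiv.Perm ℕ) (x : ℕ) : w⁻¹ (w x) = x := by simp

theorem sr_mul_self (a : ℕ) : simpleRefl a * simpleRefl a = 1 := by
  simp [simpleRefl]

theorem sr_inv (a : ℕ) : (simpleRefl a)⁻¹ = simpleRefl a := by
  simp [simpleRefl]

theorem sr_apply (a x : ℕ) :
    simpleRefl a x = if x = a then a + 1 else if x = a + 1 then a else x := by
  simp [simpleRefl, Equiv.swap_apply_def]

theorem isPermOf_mul {n a : ℕ} {w : Equiv.Perm ℕ} (hw : IsPermOf n w) (h1 : 1 ≤ a)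
    (h2 : a + 1 ≤ n) : IsPermOf n (simpleRefl a * w) := by
  intro x hx
  have h := hw x hx
  rw [Equiv.Perm.mul_apply, h, sr_apply]
  simp only [Finset.mem_Icc] at hx
  grind

theorem isPermOf_inv_mem {n : ℕ} {w : Equiv.Perm ℕ} (hw : IsPermOf n w) (x : ℕ)
    (hx : x ∈ Finset.Icc 1 n) : w⁻¹ x ∈ Finset.Icc 1 n := by
  by_contra h
  have := hw _ h
  rw [p_apply_inv] at this
  rw [← this] at h
  exact h hx

theorem isPermOf_inv {n : ℕ} {w : Equiv.Perm ℕ} (hw : IsPermOf n w) : IsPermOf n w⁻¹ := by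
  intro x hx
  rw [Equiv.Perm.inv_eq_iff_eq, hw x hx]

/-- left descent -/
def Desc (w : Equiv.Perm ℕ) (a : ℕ) : Prop := w⁻¹ (a + 1) < w⁻¹ a

theorem mul_inv_app (a : ℕ) (w : Equiv.Perm ℕ) (x : ℕ) :
    (simpleRefl a * w)⁻¹ x = w⁻¹ (simpleRefl a x) := by
  rw [mul_inv_rev, sr_inv, Equiv.Perm.mul_apply]

theorem len_desc {n a : ℕ} {w : Equiv.Perm ℕ} (hw : IsPermOf n w) (h1 : 1 ≤ a)
    (h2 : a + 1 ≤ n) (hd : Desc w a) : len n (simpleRefl a * w) + 1 = len n w := by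
  unfold len
  have hm : (w⁻¹ (a + 1), w⁻¹ a) ∈ ((Finset.Icc 1 n ×ˢ Finset.Icc 1 n).filter
      fun p => p.1 < p.2 ∧ w p.2 < w p.1) := by
    have e1 := isPermOf_inv_mem hw a (by simp; omega)
    have e2 := isPermOf_inv_mem hw (a + 1) (by simp; omega)
    simp only [Finset.mem_filter, Finset.mem_product, p_apply_inv]
    exact ⟨⟨e2, e1⟩, hd, by omega⟩
  rw [← Finset.card_erase_add_one hm]
  congr 2
  ext ⟨p, q⟩
  simp only [Finset.mem_filter, Finset.mem_product, Finset.mem_erase, ne_eq, Prod.mk.injEq,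
    Equiv.Perm.mul_apply, sr_apply]
  have hp : p = w⁻¹ (a + 1) ↔ w p = a + 1 := by
    rw [eq_comm, Equiv.Perm.inv_eq_iff_eq, eq_comm]
  have hq : q = w⁻¹ a ↔ w q = a := by
    rw [eq_comm, Equiv.Perm.inv_eq_iff_eq, eq_comm]
  have hpq : w p = w q → p = q := fun h => w.injective h
  have hx : w p = a → w q = a + 1 → q < p := by
    intro e1 e2
    unfold Desc at hd
    rw [← e2, ← e1] at hd
    simpa using hd
  rw [hp, hq]
  generalize w p = P at *
  generalize w q = Q at *
  by_cases hmem : p ∈ Finset.Icc 1 n ∧ q ∈ Finset.Icc 1 n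
  · simp only [hmem, true_and]
    clear hm hd hp hq hmem hw
    split_ifs <;> constructor <;> intro h <;> grind
  · tauto

theorem desc_or (w : Equiv.Perm ℕ) (a : ℕ) : Desc w a ∨ Desc (simpleRefl a * w) a := by
  unfold Desc
  rw [mul_inv_app, mul_inv_app, sr_apply, sr_apply]
  have : w⁻¹ (a + 1) ≠ w⁻¹ a := by
    intro h; have := w⁻¹.injective h; omega
  rw [if_neg (by omega), if_pos rfl, if_pos rfl]
  omega

theorem sr_cancel (a : ℕ) (w : Equiv.Perm ℕ) : simpleRefl a * (simpleRefl a * w) = w := by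
  rw [← mul_assoc, sr_mul_self, one_mul]

theorem len_asc {n a : ℕ} {w : Equiv.Perm ℕ} (hw : IsPermOf n w) (h1 : 1 ≤ a)
    (h2 : a + 1 ≤ n) (hd : ¬ Desc w a) : len n (simpleRefl a * w) = len n w + 1 := by
  have h := len_desc (isPermOf_mul hw h1 h2) h1 h2 ((desc_or w a).resolve_left hd)
  rw [sr_cancel] at h
  exact h.symm

theorem eq_one_of_no_desc {n : ℕ} {w : Equiv.Perm ℕ} (hw : IsPermOf n w)
    (h : ∀ a, 1 ≤ a → a + 1 ≤ n → ¬ Desc w a) : w = 1 := by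
  have hi := isPermOf_inv hw
  have hmono : StrictMono (w⁻¹ : Equiv.Perm ℕ) := by
    apply strictMono_nat_of_lt_succ
    intro a
    by_cases h1 : 1 ≤ a ∧ a + 1 ≤ n
    · have := h a h1.1 h1.2
      unfold Desc at this
      have hne : w⁻¹ (a + 1) ≠ w⁻¹ a := by
        intro h; have := w⁻¹.injective h; omega
      omega
    · by_cases ha : a ∈ Finset.Icc 1 n
      · have m := isPermOf_inv_mem hw a ha
        have e := hi (a + 1) (by simp at ha ⊢; omega)
        simp only [Finset.mem_Icc] at m ha
        omega
      · have e := hi a ha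
        by_cases ha' : a + 1 ∈ Finset.Icc 1 n
        · have m := isPermOf_inv_mem hw _ ha'
          simp only [Finset.mem_Icc] at m ha ha'
          omega
        · have := hi _ ha'
          omega
  ext x
  have h1 := hmono.le_apply (x := w x)
  rw [p_inv_apply] at h1
  have h2 := hmono.le_apply (x := x)
  have h3 : w (w⁻¹ x) = x := p_apply_inv _ _
  have hmono2 : StrictMono w := by
    intro p q hpq
    by_contra hc
    have := hmono.monotone (not_lt.1 hc)
    simp at this
    omega
  have h4 := hmono2.le_apply (x := x)
  simp only [Equiv.Perm.one_apply]
  omega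

theorem len_one (n : ℕ) : len n 1 = 0 := by
  unfold len
  rw [Finset.card_eq_zero, Finset.filter_eq_empty_iff]
  intro p _ h
  simp at h
  omega

theorem reduced_cons {n a : ℕ} {w : Equiv.Perm ℕ} {L : List ℕ} (hw : IsPermOf n w) (h1 : 1 ≤ a)
    (h2 : a + 1 ≤ n) (hd : Desc w a) (hL : IsReducedWord n (simpleRefl a * w) L) :
    IsReducedWord n w (a :: L) := by
  obtain ⟨⟨hm, hp⟩, hl⟩ := hL
  refine ⟨⟨?_, ?_⟩, ?_⟩
  · intro i hi
    rcases List.mem_cons.1 hi with rfl | hi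
    · omega
    · exact hm i hi
  · rw [List.map_cons, List.prod_cons, hp, sr_cancel]
  · rw [List.length_cons, hl, len_desc hw h1 h2 hd]

theorem exists_reduced (n : ℕ) : ∀ (m : ℕ) (w : Equiv.Perm ℕ), IsPermOf n w → len n w = m →
    ∃ L, IsReducedWord n w L := by
  intro m
  induction m with
  | zero =>
    intro w hw hl
    have : w = 1 := by
      apply eq_one_of_no_desc hw
      intro a h1 h2 hd
      have := len_desc hw h1 h2 hd
      omega
    subst this
    exact ⟨[], ⟨by simp, by simp⟩, by simp [hl]⟩
  | succ m ih =>
    intro w hw hl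
    by_cases h : ∃ a, 1 ≤ a ∧ a + 1 ≤ n ∧ Desc w a
    · obtain ⟨a, h1, h2, hd⟩ := h
      obtain ⟨L, hL⟩ := ih (simpleRefl a * w) (isPermOf_mul hw h1 h2)
        (by have := len_desc hw h1 h2 hd; omega)
      exact ⟨a :: L, reduced_cons hw h1 h2 hd hL⟩
    · have : w = 1 := by
        apply eq_one_of_no_desc hw
        intro a h1 h2 hd
        exact h ⟨a, h1, h2, hd⟩
      rw [this, len_one] at hl
      omega

theorem word_cons {n a : ℕ} {w : Equiv.Perm ℕ} {L : List ℕ} (h : IsWord n w (a :: L)) :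
    1 ≤ a ∧ a + 1 ≤ n ∧ IsWord n (simpleRefl a * w) L := by
  obtain ⟨hm, hp⟩ := h
  have := hm a (by simp)
  refine ⟨this.1, by omega, fun i hi => hm i (by simp [hi]), ?_⟩
  rw [← hp, List.map_cons, List.prod_cons, sr_cancel]

theorem len_le (n : ℕ) : ∀ (L : List ℕ) (w : Equiv.Perm ℕ), IsPermOf n w → IsWord n w L →
    len n w ≤ L.length := by
  intro L
  induction L with
  | nil =>
    intro w _ h
    have := h.2
    simp at this
    rw [← this, len_one]
    simp
  | cons a L ih =>
    intro w hw h
    obtain ⟨h1, h2, h3⟩ := word_cons h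
    have := ih _ (isPermOf_mul hw h1 h2) h3
    rw [List.length_cons]
    by_cases hd : Desc w a
    · have := len_desc hw h1 h2 hd; omega
    · have := len_asc hw h1 h2 hd; omega

theorem reduced_uncons {n a : ℕ} {w : Equiv.Perm ℕ} {L : List ℕ} (hw : IsPermOf n w)
    (h : IsReducedWord n w (a :: L)) :
    1 ≤ a ∧ a + 1 ≤ n ∧ Desc w a ∧ IsReducedWord n (simpleRefl a * w) L := by
  obtain ⟨h1, h2, h3⟩ := word_cons h.1
  have hle := len_le n _ _ (isPermOf_mul hw h1 h2) h3
  have hl := h.2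
  rw [List.length_cons] at hl
  by_cases hd : Desc w a
  · have := len_desc hw h1 h2 hd
    exact ⟨h1, h2, hd, h3, by omega⟩
  · have := len_asc hw h1 h2 hd; omega

theorem sr_comm {a b : ℕ} (h : a + 2 ≤ b) :
    simpleRefl a * simpleRefl b = simpleRefl b * simpleRefl a := by
  ext x
  simp only [Equiv.Perm.mul_apply, sr_apply]
  grind

theorem sr_braid (a : ℕ) :
    simpleRefl a * (simpleRefl (a + 1) * simpleRefl a) =
      simpleRefl (a + 1) * (simpleRefl a * simpleRefl (a + 1)) := by
  ext x
  simp only [Equiv.Perm.mul_apply, sr_apply]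
  grind

/-- replacing an infix by another with the same letters, product and length -/
theorem reduced_replace {n : ℕ} {w : Equiv.Perm ℕ} (A B X Y : List ℕ)
    (hmem : ∀ i ∈ Y, i ∈ X) (hprod : (X.map simpleRefl).prod = (Y.map simpleRefl).prod)
    (hlen : X.length = Y.length) (h : IsReducedWord n w (A ++ X ++ B)) :
    IsReducedWord n w (A ++ Y ++ B) := by
  obtain ⟨⟨hm, hp⟩, hl⟩ := h
  refine ⟨⟨?_, ?_⟩, ?_⟩
  · intro i hi
    apply hm
    simp only [List.mem_append] at hi ⊢
    rcases hi with (hi | hi) | hi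
    · exact Or.inl (Or.inl hi)
    · exact Or.inl (Or.inr (hmem i hi))
    · exact Or.inr hi
  · rw [← hp]
    simp only [List.map_append, List.prod_append, hprod]
  · rw [← hl]
    simp only [List.length_append, hlen]

def NoBraid (n k : ℕ) (w : Equiv.Perm ℕ) : Prop :=
  ∀ L, IsReducedWord n w L → ¬ ([k, k - 1, k] <:+: L ∨ [k, k + 1, k] <:+: L)

theorem count_eq (n k : ℕ) : ∀ (m : ℕ) (w : Equiv.Perm ℕ), IsPermOf n w → NoBraid n k w →
    len n w = m → ∀ L1 L2, IsReducedWord n w L1 → IsReducedWord n w L2 →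
    L1.count k = L2.count k := by
  intro m
  induction m with
  | zero =>
    intro w _ _ hl L1 L2 r1 r2
    have e1 := r1.2
    have e2 := r2.2
    rw [hl] at e1 e2
    rw [List.length_eq_zero_iff.1 e1, List.length_eq_zero_iff.1 e2]
  | succ m ih =>
    intro w hw hnb hl
    have same : ∀ a L1 L2, IsReducedWord n w (a :: L1) → IsReducedWord n w (a :: L2) →
        (a :: L1).count k = (a :: L2).count k := by
      intro a L1 L2 r1 r2
      obtain ⟨h1, h2, hd, r1'⟩ := reduced_uncons hw r1
      obtain ⟨_, _, _, r2'⟩ := reduced_uncons hw r2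
      have := ih _ (isPermOf_mul hw h1 h2) ?_ ?_ L1 L2 r1' r2'
      · rw [List.count_cons, List.count_cons, this]
      · intro L hL hc
        refine hnb _ (reduced_cons hw h1 h2 hd hL) ?_
        exact hc.imp (fun h => h.trans (List.suffix_cons a L).isInfix)
          (fun h => h.trans (List.suffix_cons a L).isInfix)
      · have := len_desc hw h1 h2 hd; omega
    have main : ∀ a b L1 L2, a < b → IsReducedWord n w (a :: L1) → IsReducedWord n w (b :: L2) →
        (a :: L1).count k = (b :: L2).count k := by
      intro a b L1 L2 hab r1 r2
      obtain ⟨ha1, ha2, hda, -⟩ := reduced_uncons hw r1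
      obtain ⟨hb1, hb2, hdb, -⟩ := reduced_uncons hw r2
      have hwa := isPermOf_mul hw ha1 ha2
      have hwba := isPermOf_mul hwa hb1 hb2
      unfold Desc at hda hdb
      by_cases hc : a + 2 ≤ b
      · have hd : Desc (simpleRefl a * w) b := by
          unfold Desc
          rw [mul_inv_app, mul_inv_app, sr_apply, sr_apply]
          rw [if_neg (by omega), if_neg (by omega), if_neg (by omega), if_neg (by omega)]
          exact hdb
        obtain ⟨M, hM⟩ := exists_reduced n _ _ hwba rfl
        have r3 := reduced_cons hw ha1 ha2 hda (reduced_cons hwa hb1 hb2 hd hM)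
        have r4 : IsReducedWord n w (b :: a :: M) :=
          reduced_replace [] M [a, b] [b, a] (by simp) (by simp [sr_comm hc]) rfl r3
        rw [same _ _ _ r1 r3, same _ _ _ r2 r4]
        exact (List.Perm.swap b a M).count_eq k
      · obtain rfl : b = a + 1 := by omega
        have hd : Desc (simpleRefl a * w) (a + 1) := by
          unfold Desc
          rw [mul_inv_app, mul_inv_app, sr_apply, sr_apply]
          rw [if_neg (by omega), if_neg (by omega), if_neg (by omega), if_pos rfl]
          omega
        have hd2 : Desc (simpleRefl (a + 1) * (simpleRefl a * w)) a := by
          unfold Desc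
          rw [mul_inv_app, mul_inv_app, mul_inv_app, mul_inv_app]
          have e1 : simpleRefl a (simpleRefl (a + 1) (a + 1)) = a + 1 + 1 := by
            simp only [sr_apply]; grind
          have e2 : simpleRefl a (simpleRefl (a + 1) a) = a + 1 := by
            simp only [sr_apply]; grind
          rw [e1, e2]
          exact hdb
        obtain ⟨M, hM⟩ := exists_reduced n _ _ (isPermOf_mul hwba ha1 ha2) rfl
        have r3 := reduced_cons hw ha1 ha2 hda (reduced_cons hwa hb1 hb2 hd
          (reduced_cons hwba ha1 ha2 hd2 hM))
        have r4 : IsReducedWord n w ((a + 1) :: a :: (a + 1) :: M) :=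
          reduced_replace [] M [a, a + 1, a] [a + 1, a, a + 1] (by simp)
            (by simpa using sr_braid a) rfl r3
        have hka : a ≠ k := by
          rintro rfl
          exact hnb _ r3 (Or.inr ⟨[], M, rfl⟩)
        have hkb : a + 1 ≠ k := by
          rintro rfl
          exact hnb _ r4 (Or.inl ⟨[], M, rfl⟩)
        rw [same _ _ _ r1 r3, same _ _ _ r2 r4]
        simp [List.count_cons, hka, hkb]
    intro L1 L2 r1 r2
    rcases L1 with _ | ⟨a, L1⟩
    · have := r1.2; simp at this; omega
    rcases L2 with _ | ⟨b, L2⟩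
    · have := r2.2; simp at this; omega
    rcases lt_trichotomy a b with h | rfl | h
    · exact main _ _ _ _ h r1 r2
    · exact same _ _ _ r1 r2
    · exact (main _ _ _ _ h r2 r1).symm

theorem minOcc_lt_of {n k : ℕ} {w : Equiv.Perm ℕ} {L1 L2 : List ℕ} (r1 : IsReducedWord n w L1)
    (r2 : IsReducedWord n w L2) (h : L1.count k < L2.count k) : minOcc n k w < maxOcc n k w := by
  refine lt_of_le_of_lt (Nat.sInf_le ⟨L1, r1, rfl⟩) (lt_of_lt_of_le h ?_)
  refine le_csSup ⟨len n w, ?_⟩ ⟨L2, r2, rfl⟩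
  rintro m ⟨L, hL, rfl⟩
  rw [← hL.2]
  exact List.count_le_length

/-- `max_k(w) > min_k(w)` if and only if some reduced decomposition
of `w` contains three consecutive factors `σ_k σ_{k-1} σ_k` or `σ_k σ_{k+1} σ_k`. -/
theorem maxOcc_gt_minOcc_iff_braid_infix (n : ℕ) (hn : 2 ≤ n) (w : Equiv.Perm ℕ)
    (hw : IsPermOf n w) (k : ℕ) (hk1 : 1 ≤ k) (hk2 : k ≤ n - 1) :
    minOcc n k w < maxOcc n k w ↔
      ∃ L : List ℕ, IsReducedWord n w L ∧
        ([k, k - 1, k] <:+: L ∨ [k, k + 1, k] <:+: L) := by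
  constructor
  · intro h
    by_contra hc
    push Not at hc
    have hnb : NoBraid n k w := by
      intro L hL hh
      rcases hh with hh | hh
      · exact (hc L hL).1 hh
      · exact (hc L hL).2 hh
    obtain ⟨L, hL⟩ := exists_reduced n _ w hw rfl
    have hs : {m | ∃ L : List ℕ, IsReducedWord n w L ∧ L.count k = m} = {L.count k} := by
      ext m
      constructor
      · rintro ⟨L', hL', rfl⟩
        exact count_eq n k _ w hw hnb rfl _ _ hL' hL
      · rintro rfl
        exact ⟨L, hL, rfl⟩
    unfold minOcc maxOcc at h
    rw [hs] at h
    simp at h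
  · rintro ⟨L, hL, ⟨A, B, rfl⟩ | ⟨A, B, rfl⟩⟩
    · have hk : 1 ≤ k - 1 := (hL.1.1 (k - 1) (by simp)).1
      obtain ⟨j, rfl⟩ : ∃ j, k = j + 1 := ⟨k - 1, by omega⟩
      rw [Nat.add_sub_cancel] at hL
      have r := reduced_replace A B [j + 1, j, j + 1] [j, j + 1, j] (by simp)
        (by simpa using (sr_braid j).symm) rfl hL
      refine minOcc_lt_of r hL ?_
      simp [List.count_append, List.count_cons]
    · have r := reduced_replace A B [k, k + 1, k] [k + 1, k, k + 1] (by simp)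
        (by simpa using sr_braid k) rfl hL
      refine minOcc_lt_of r hL ?_
      simp [List.count_append, List.count_cons]
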